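/- Let Λ and Λ' be finite alphabets with 0 ∈ Λ, let Ω₊ = (Λ×Λ')^ℕ with the shift T, and let μ be a shift-invariant probability measure on Ω₊ such that the system (Ω₊,μ,T) is exact. Suppose there exists a finite word ã over Λ such that μ{ω : ω¹ = ã0^∞} > 0, where ã0^∞ is the sequence consisting of the prefix ã followed by infinitely many zeros. Then μ{ω : ω¹ = 0^∞} = 1, i.e. μ-almost every ω has first coordinate sequence identically zero. -/

import Mathlib

open MeasureTheory Filter Topology

/-- The one-sided shift on sequences. -/
def shiftN {A : Type*} (ω : ℕ → A) : ℕ → A := fun k => ω (k + 1)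

/-- The concatenation `aω` of a finite word `a` with an infinite sequence `ω`. -/
def prepend {A : Type*} (a : List A) (ω : ℕ → A) : ℕ → A :=
  fun i => if h : i < a.length then a.get ⟨i, h⟩ else ω (i - a.length)

/-- A measure-preserving system is exact if every set belonging to `⋂ n, T⁻ⁿ(𝓑)`
has measure `0` or `1`. -/
def Exact {Ω : Type*} [MeasurableSpace Ω] (T : Ω → Ω) (μ : Measure Ω) : Prop :=
  ∀ A : Set Ω, (∀ n : ℕ, ∃ B : Set Ω, MeasurableSet B ∧ A = T^[n] ⁻¹' B) →
    μ A = 0 ∨ μ A = 1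

theorem shiftN_iterate_apply {A : Type*} (n : ℕ) (ω : ℕ → A) (k : ℕ) :
    shiftN^[n] ω k = ω (k + n) := by
  induction n generalizing ω with
  | zero => rfl
  | succ n ih =>
    rw [Function.iterate_succ_apply, ih]
    simp only [shiftN, Nat.add_assoc]

theorem measurable_shiftN {A : Type*} [MeasurableSpace A] :
    Measurable (shiftN : (ℕ → A) → ℕ → A) :=
  measurable_pi_lambda _ fun k => measurable_pi_apply (k + 1)

theorem eventually_shiftN_iterate {A : Type*} (p : A → Prop) (n : ℕ) (ω : ℕ → A) :
    (∀ᶠ k in atTop, p (shiftN^[n] ω k)) ↔ ∀ᶠ k in atTop, p (ω k) := by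
  simp only [shiftN_iterate_apply]
  rw [← eventually_map (m := fun k => k + n) (P := fun k => p (ω k)), map_add_atTop_eq_nat]

theorem setOf_eventually_eq_iUnion_preimage {A : Type*} (p : A → Prop) :
    {ω : ℕ → A | ∀ᶠ k in atTop, p (ω k)} = ⋃ n, shiftN^[n] ⁻¹' {ω | ∀ k, p (ω k)} := by
  ext ω
  simp only [Set.mem_ofPred_eq, Set.mem_iUnion, Set.mem_preimage, shiftN_iterate_apply,
    eventually_atTop]
  refine exists_congr fun n => ⟨fun h k => h _ (Nat.le_add_left n k), fun h k hk => ?_⟩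
  simpa only [Nat.sub_add_cancel hk] using h (k - n)

theorem measurableSet_setOf_forall_apply {A : Type*} [MeasurableSpace A] {p : A → Prop}
    (hp : MeasurableSet {a | p a}) : MeasurableSet {ω : ℕ → A | ∀ k, p (ω k)} := by
  rw [Set.ofPred_forall]
  exact MeasurableSet.iInter fun k => measurable_pi_apply k hp

/-- For a shift-invariant measure, a property holds eventually along a sequence with the same
probability as it holds along the whole sequence. -/
theorem measure_eventually_eq_measure_forall {A : Type*} [MeasurableSpace A]
    {μ : Measure (ℕ → A)} (hinv : MeasurePreserving shiftN μ μ) {p : A → Prop}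
    (hp : MeasurableSet {a | p a}) :
    μ {ω | ∀ᶠ k in atTop, p (ω k)} = μ {ω | ∀ k, p (ω k)} := by
  have hmono : Monotone fun n => shiftN^[n] ⁻¹' {ω : ℕ → A | ∀ k, p (ω k)} := by
    refine monotone_nat_of_le_succ fun n ω h k => ?_
    have := h (k + 1)
    rw [shiftN_iterate_apply] at this ⊢
    rwa [Nat.add_assoc, Nat.add_comm 1 n] at this
  rw [setOf_eventually_eq_iUnion_preimage, hmono.measure_iUnion]
  simp only [(hinv.iterate _).measure_preimage
    (measurableSet_setOf_forall_apply hp).nullMeasurableSet, ciSup_const]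

theorem Exact.measure_forall_eq_zero_or_one {A : Type*} [MeasurableSpace A]
    {μ : Measure (ℕ → A)} (hexact : Exact shiftN μ) (hinv : MeasurePreserving shiftN μ μ)
    {p : A → Prop} (hp : MeasurableSet {a | p a}) :
    μ {ω | ∀ k, p (ω k)} = 0 ∨ μ {ω | ∀ k, p (ω k)} = 1 := by
  rw [← measure_eventually_eq_measure_forall hinv hp]
  refine hexact _ fun n => ⟨{ω | ∀ᶠ k in atTop, p (ω k)}, ?_, ?_⟩
  · rw [setOf_eventually_eq_iUnion_preimage]
    exact MeasurableSet.iUnion fun m =>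
      measurable_shiftN.iterate m (measurableSet_setOf_forall_apply hp)
  · ext ω
    exact (eventually_shiftN_iterate p n ω).symm

theorem prepend_of_length_le {A : Type*} {a : List A} {i : ℕ} (h : a.length ≤ i) (ω : ℕ → A) :
    prepend a ω i = ω (i - a.length) :=
  dif_neg (Nat.not_lt.mpr h)

theorem stmt11 {Λ Λ' : Type*} [Fintype Λ] [Fintype Λ']
    [MeasurableSpace Λ] [DiscreteMeasurableSpace Λ]
    [MeasurableSpace Λ'] [DiscreteMeasurableSpace Λ']
    (z : Λ)  -- the symbol `0 ∈ Λ`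
    (μ : Measure (ℕ → Λ × Λ')) [IsProbabilityMeasure μ]
    (hinv : μ.map shiftN = μ) (hexact : Exact shiftN μ)
    (atil : List Λ)
    (hpos : 0 < μ {ω | ∀ k : ℕ, (ω k).1 = prepend atil (fun _ => z) k}) :
    μ {ω | ∀ k : ℕ, (ω k).1 = z} = 1 := by
  have hmp : MeasurePreserving shiftN μ μ := ⟨measurable_shiftN, hinv⟩
  have hp : MeasurableSet {a : Λ × Λ' | a.1 = z} :=
    measurable_fst (MeasurableSet.of_discrete (s := {z}))
  refine (hexact.measure_forall_eq_zero_or_one hmp hp).resolve_left fun h0 => ?_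
  rw [← measure_eventually_eq_measure_forall hmp hp] at h0
  refine hpos.ne' (measure_mono_null (fun ω hω => ?_) h0)
  filter_upwards [eventually_ge_atTop atil.length] with k hk
  rw [hω k, prepend_of_length_le hk]
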